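/- Let N ≥ 2 be an integer, g > 0, h > 0, u_m ∈ ℝ, and α₁ a nonzero real number. Then the matrix A^{PHSWME}_p has N+2 pairwise distinct real eigenvalues, namely the numbers u_m + α₁·r for each of the N real roots r of P'_{N+1}, together with u_m + √(gh + α₁²) and u_m − √(gh + α₁²); in particular, A^{PHSWME}_p is diagonalizable over ℝ. -/

import Mathlib

open Polynomial

/-- The Legendre polynomial of degree `n` (Rodrigues' formula), normalized so `P n 1 = 1`. -/
noncomputable def legendre (n : ℕ) : Polynomial ℝ :=
  ((2 ^ n * n.factorial : ℝ))⁻¹ • (derivative^[n] ((X ^ 2 - 1) ^ n))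

/-- Entry `(i,j)` (0-based) of the tridiagonal matrix `A₂`. -/
noncomputable def A2entry (α1 : ℝ) (i j : ℕ) : ℝ :=
  if j = i + 1 then ((i : ℝ) + 3) / (2 * (i : ℝ) + 5) * α1
  else if i = j + 1 then ((j : ℝ) + 1) / (2 * (j : ℝ) + 3) * α1
  else 0

/-- The PHSWME system matrix in primitive variables. -/
noncomputable def APHSWMEp (N : ℕ) (g h um α1 : ℝ) :
    Matrix (Fin (N + 2)) (Fin (N + 2)) ℝ := fun r c =>
  if r.val = 0 then (if c.val = 0 then um else if c.val = 1 then h else 0)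
  else if r.val = 1 then
    (if c.val = 0 then g + α1 ^ 2 / (3 * h)
     else if c.val = 1 then um
     else if c.val = 2 then 2 / 3 * α1 else 0)
  else if c.val = 0 then (if r.val = 3 then -(α1 ^ 2) / (3 * h) else 0)
  else if c.val = 1 then (if r.val = 2 then α1 else 0)
  else (if r = c then um else 0) + A2entry α1 (r.val - 2) (c.val - 2)

/-! ### Matrices with as many eigenvalues as rows -/

section Diagonalization

variable {n K : Type*} [Fintype n] [DecidableEq n] [Field K]

theorem Matrix.finite_spectrum_and_ncard_le (A : Matrix n n K) :
    (spectrum K A).Finite ∧ (spectrum K A).ncard ≤ Fintype.card n := by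
  classical
  have hset : spectrum K A = ↑A.charpoly.roots.toFinset := by
    ext x
    simp [Matrix.mem_spectrum_iff_isRoot_charpoly, A.charpoly_monic.ne_zero]
  rw [hset, Set.ncard_coe_finset]
  refine ⟨Finset.finite_toSet _, (Multiset.toFinset_card_le _).trans ?_⟩
  simpa [A.charpoly_natDegree_eq_dim] using Polynomial.card_roots' A.charpoly

theorem Matrix.exists_eq_mul_diagonal_mul_inv_of_ncard_spectrum (A : Matrix n n K)
    (h : (spectrum K A).ncard = Fintype.card n) :
    ∃ P D : Matrix n n K, IsUnit P ∧ D.IsDiag ∧ A = P * D * P⁻¹ := by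
  have hfin := A.finite_spectrum_and_ncard_le.1
  have := hfin.fintype
  have hcard : Fintype.card n = Fintype.card (spectrum K A) := by
    rw [← h, ← Nat.card_coe_set_eq, Nat.card_eq_fintype_card]
  let e : n ≃ spectrum K A := Fintype.equivOfCardEq hcard
  have hev : ∀ i, ∃ v, Module.End.HasEigenvector (Matrix.toLin' A) (e i : K) v := fun i => by
    refine Module.End.HasEigenvalue.exists_hasEigenvector ?_
    rw [Module.End.hasEigenvalue_iff_mem_spectrum, Matrix.spectrum_toLin']
    exact (e i).2
  choose v hv using hev
  have hli : LinearIndependent K v :=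
    Module.End.eigenvectors_linearIndependent' _ (fun i => (e i : K))
      (Subtype.val_injective.comp e.injective) v hv
  let P : Matrix n n K := Matrix.of fun i j => v j i
  have hP : IsUnit P := Matrix.linearIndependent_cols_iff_isUnit.1 hli
  refine ⟨P, Matrix.diagonal fun i => (e i : K), hP, Matrix.isDiag_diagonal _, ?_⟩
  have hAP : A * P = P * Matrix.diagonal fun i => (e i : K) := by
    ext i j
    have := congrFun (hv j).apply_eq_smul i
    rw [Matrix.toLin'_apply] at this
    rw [Matrix.mul_diagonal]
    simpa [P, Matrix.mul_apply, Matrix.mulVec, dotProduct, mul_comm] using this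
  rw [← hAP, Matrix.mul_nonsing_inv_cancel_right _ _ ((Matrix.isUnit_iff_isUnit_det _).1 hP)]

theorem Matrix.mem_spectrum_of_mulVec_eq_smul {A : Matrix n n K} {x : K} {v : n → K}
    (hv : v ≠ 0) (h : A.mulVec v = x • v) : x ∈ spectrum K A := by
  rw [← Matrix.spectrum_toLin', ← Module.End.hasEigenvalue_iff_mem_spectrum]
  exact Module.End.hasEigenvalue_of_hasEigenvector
    (Module.End.hasEigenvector_iff.2 ⟨Module.End.mem_eigenspace_iff.2 (by simpa using h), hv⟩)

theorem Matrix.mem_spectrum_of_vecMul_eq_smul {A : Matrix n n K} {x : K} {v : n → K}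
    (hv : v ≠ 0) (h : A.vecMul v = x • v) : x ∈ spectrum K A := by
  have := Matrix.mem_spectrum_of_mulVec_eq_smul (A := A.transpose) hv
    (by rw [Matrix.mulVec_transpose, h])
  rwa [Matrix.mem_spectrum_iff_isRoot_charpoly, Matrix.charpoly_transpose,
    ← Matrix.mem_spectrum_iff_isRoot_charpoly] at this

end Diagonalization

/-! ### Legendre polynomials -/

/-- The `n`-fold antiderivative of the Legendre polynomial in Rodrigues' formula. -/
noncomputable def rodrigues (n : ℕ) : ℝ[X] :=
  ((2 ^ n * n.factorial : ℝ))⁻¹ • (X ^ 2 - 1) ^ n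

theorem legendre_eq_iterate_derivative (n : ℕ) :
    legendre n = derivative^[n] (rodrigues n) := by
  rw [legendre, rodrigues, iterate_derivative_smul]

theorem rodrigues_succ (n : ℕ) :
    C (2 * ((n : ℝ) + 1)) * rodrigues (n + 1) = (X ^ 2 - 1) * rodrigues n := by
  have h : 2 * ((n : ℝ) + 1) * (2 ^ (n + 1) * (n + 1).factorial : ℝ)⁻¹ =
      (2 ^ n * n.factorial : ℝ)⁻¹ := by
    rw [Nat.factorial_succ]
    push_cast
    field_simp
    ring
  rw [rodrigues, rodrigues, ← smul_eq_C_mul, smul_smul, h, mul_smul_comm, pow_succ']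

theorem derivative_rodrigues_succ (n : ℕ) :
    derivative (rodrigues (n + 1)) = rodrigues n * X := by
  have h : (2 ^ (n + 1) * (n + 1).factorial : ℝ)⁻¹ * (2 * ((n : ℝ) + 1)) =
      (2 ^ n * n.factorial : ℝ)⁻¹ := by
    rw [Nat.factorial_succ]
    push_cast
    field_simp
    ring
  rw [rodrigues, rodrigues, ← h, derivative_smul, derivative_pow]
  simp only [smul_eq_C_mul, C_mul, C_add, derivative_sub, derivative_X_sq, derivative_one,
    Nat.add_sub_cancel, C_ofNat, map_natCast, map_one, Nat.cast_add, Nat.cast_one]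
  ring

theorem derivative_derivative_rodrigues (n : ℕ) :
    derivative (derivative (rodrigues (n + 2))) =
      C (2 * (n : ℝ) + 3) * rodrigues (n + 1) + rodrigues n := by
  have h := rodrigues_succ n
  rw [derivative_rodrigues_succ, derivative_mul, derivative_rodrigues_succ, derivative_X]
  simp only [C_mul, C_add, C_ofNat, map_natCast, map_one] at h ⊢
  linear_combination -h

theorem derivative_legendre_succ (n : ℕ) :
    derivative (legendre (n + 1)) =
      X * derivative (legendre n) + C ((n : ℝ) + 1) * legendre n := by
  simp only [legendre_eq_iterate_derivative]
  rw [← Function.iterate_succ_apply' derivative (n + 1), Function.iterate_succ_apply,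
    derivative_rodrigues_succ, iterate_derivative_mul_X, Function.iterate_succ_apply']
  simp [nsmul_eq_mul, mul_comm]

theorem derivative_legendre_add_two (n : ℕ) :
    derivative (legendre (n + 2)) =
      C (2 * (n : ℝ) + 3) * legendre (n + 1) + derivative (legendre n) := by
  simp only [legendre_eq_iterate_derivative]
  rw [← Function.iterate_succ_apply' derivative (n + 2), Function.iterate_succ_apply,
    Function.iterate_succ_apply, derivative_derivative_rodrigues, iterate_map_add,
    iterate_derivative_C_mul, Function.iterate_succ_apply' derivative n (rodrigues n)]

theorem legendre_zero : legendre 0 = 1 := by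
  simp [legendre]

theorem derivative_legendre_one : derivative (legendre 1) = 1 := by
  simpa [legendre_zero] using derivative_legendre_succ 0

theorem eval_derivative_legendre_recurrence (n : ℕ) (x : ℝ) :
    ((n : ℝ) + 1) * (derivative (legendre (n + 2))).eval x =
      (2 * (n : ℝ) + 3) * x * (derivative (legendre (n + 1))).eval x -
        ((n : ℝ) + 2) * (derivative (legendre n)).eval x := by
  have h₁ := congrArg (eval x) (derivative_legendre_succ (n + 1))
  have h₂ := congrArg (eval x) (derivative_legendre_add_two n)
  simp only [eval_add, eval_mul, eval_X, eval_C, Nat.cast_add, Nat.cast_one] at h₁ h₂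
  linear_combination (2 * (n : ℝ) + 3) * h₁ - ((n : ℝ) + 2) * h₂

theorem abs_eval_derivative_legendre_lt {x : ℝ} (hx : 1 ≤ |x|) (n : ℕ) :
    |(derivative (legendre n)).eval x| < |(derivative (legendre (n + 1))).eval x| := by
  induction n with
  | zero => simp [legendre_zero, derivative_legendre_one]
  | succ n ih =>
    have h := eval_derivative_legendre_recurrence n x
    set a := (derivative (legendre n)).eval x
    set b := (derivative (legendre (n + 1))).eval x
    set c := (derivative (legendre (n + 2))).eval x
    have hn : (0 : ℝ) ≤ n := n.cast_nonneg
    have h₁ := congrArg abs (eq_add_of_sub_eq h.symm)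
    have h₂ := abs_add_le (((n : ℝ) + 1) * c) (((n : ℝ) + 2) * a)
    simp only [abs_mul] at h₁ h₂
    rw [← h₁, abs_of_nonneg (by positivity : (0 : ℝ) ≤ 2 * n + 3),
      abs_of_nonneg (by positivity : (0 : ℝ) ≤ n + 1),
      abs_of_nonneg (by positivity : (0 : ℝ) ≤ n + 2)] at h₂
    have h₃ : (2 * (n : ℝ) + 3) * |b| ≤ (2 * n + 3) * |x| * |b| := by
      rw [mul_assoc]
      exact mul_le_mul_of_nonneg_left (le_mul_of_one_le_left (abs_nonneg b) hx) (by positivity)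
    nlinarith

theorem abs_lt_one_of_eval_derivative_legendre_eq_zero {n : ℕ} {x : ℝ}
    (h : (derivative (legendre (n + 1))).eval x = 0) : |x| < 1 := by
  by_contra! hx
  have := abs_eval_derivative_legendre_lt hx n
  rw [h, abs_zero] at this
  exact absurd this (abs_nonneg _).not_gt

theorem derivative_legendre_succ_ne_zero (n : ℕ) : derivative (legendre (n + 1)) ≠ 0 := fun h => by
  have := abs_lt_one_of_eval_derivative_legendre_eq_zero (n := n) (x := 1) (by simp [h])
  simp at this

theorem iterate_derivative_rodrigues_ne_zero {n k : ℕ} (hk : k ≤ n) :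
    derivative^[k] (rodrigues n) ≠ 0 := fun h => by
  cases n with
  | zero => simp [Nat.le_zero.1 hk, rodrigues] at h
  | succ n =>
    apply derivative_legendre_succ_ne_zero n
    obtain ⟨m, hm⟩ := Nat.exists_eq_add_of_le' hk
    rw [legendre_eq_iterate_derivative]
    nth_rewrite 1 [hm]
    rw [Function.iterate_add_apply, h, iterate_derivative_zero, derivative_zero]

theorem eval_iterate_derivative_rodrigues_eq_zero {n k : ℕ} (hk : k < n) {x : ℝ}
    (hx : x ^ 2 = 1) : (derivative^[k] (rodrigues n)).eval x = 0 := by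
  rw [rodrigues, iterate_derivative_smul, eval_smul]
  obtain ⟨q, hq⟩ := pow_sub_dvd_iterate_derivative_pow (X ^ 2 - 1 : ℝ[X]) n k
  rw [hq]
  simp [hx, Nat.sub_ne_zero_of_lt hk]

theorem le_card_roots_iterate_derivative_rodrigues {n k : ℕ} (hk : k ≤ n) :
    k ≤ ((derivative^[k] (rodrigues n)).roots.toFinset \ {1, -1}).card := by
  induction k with
  | zero => simp
  | succ k ih =>
    have hk' : k < n := hk
    set f := derivative^[k] (rodrigues n) with hf
    have hsub : ({1, -1} : Finset ℝ) ⊆ f.roots.toFinset := by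
      intro x hx
      have hx2 : x ^ 2 = 1 := by
        rcases Finset.mem_insert.1 hx with rfl | hx
        · norm_num
        · rw [Finset.mem_singleton.1 hx]; norm_num
      rw [Multiset.mem_toFinset, mem_roots (iterate_derivative_rodrigues_ne_zero hk'.le)]
      exact eval_iterate_derivative_rodrigues_eq_zero hk' hx2
    have hpair : ({1, -1} : Finset ℝ).card = 2 := Finset.card_pair (by norm_num)
    have h₁ := Finset.card_sdiff_add_card_eq_card hsub
    have h₂ := card_roots_toFinset_le_card_roots_derivative_sdiff_roots_succ f
    have h₃ := Finset.card_le_card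
      (Finset.sdiff_subset_sdiff (Finset.Subset.refl (derivative f).roots.toFinset) hsub)
    rw [Function.iterate_succ_apply', ← hf]
    have := ih hk'.le
    omega

theorem le_card_roots_derivative_legendre (n : ℕ) :
    n ≤ (derivative (legendre (n + 1))).roots.toFinset.card := by
  have h₁ := le_card_roots_iterate_derivative_rodrigues (le_refl (n + 1))
  rw [← legendre_eq_iterate_derivative] at h₁
  have h₂ := Finset.card_le_card (Finset.sdiff_subset (s := (legendre (n + 1)).roots.toFinset)
    (t := {1, -1}))
  have h₃ := card_roots_toFinset_le_derivative (legendre (n + 1))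
  omega

theorem setOf_eval_derivative_legendre_eq_zero (n : ℕ) :
    {r : ℝ | (derivative (legendre (n + 1))).eval r = 0} =
      ↑(derivative (legendre (n + 1))).roots.toFinset := by
  ext r
  rw [Finset.mem_coe, Multiset.mem_toFinset, mem_roots (derivative_legendre_succ_ne_zero n)]
  rfl

/-! ### Eigenvectors of the system matrix -/

theorem Fin.sum_mul_ite_val_eq {M k : ℕ} {f : ℕ → ℝ} (c : ℝ) (h : k < M ∨ f k = 0) :
    ∑ i : Fin M, f i * (if (i : ℕ) = k then c else 0) = f k * c := by
  rw [Fin.sum_univ_eq_sum_range (fun i => f i * (if i = k then c else 0))]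
  simp only [mul_ite, mul_zero, Finset.sum_ite_eq', Finset.mem_range]
  split_ifs with hk
  · rfl
  · simp [h.resolve_left hk]

theorem APHSWMEp_apply_zero {N : ℕ} (g h um α1 : ℝ) (i j : Fin (N + 2)) (hj : (j : ℕ) = 0) :
    APHSWMEp N g h um α1 i j = (if (i : ℕ) = 0 then um else 0) +
      (if (i : ℕ) = 1 then g + α1 ^ 2 / (3 * h) else 0) +
      (if (i : ℕ) = 3 then -(α1 ^ 2) / (3 * h) else 0) := by
  simp only [APHSWMEp, hj]
  split_ifs <;> first | omega | contradiction | simp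

theorem APHSWMEp_apply_one {N : ℕ} (g h um α1 : ℝ) (i j : Fin (N + 2)) (hj : (j : ℕ) = 1) :
    APHSWMEp N g h um α1 i j = (if (i : ℕ) = 0 then h else 0) +
      (if (i : ℕ) = 1 then um else 0) + (if (i : ℕ) = 2 then α1 else 0) := by
  simp only [APHSWMEp, hj]
  split_ifs <;> first | omega | contradiction | simp

theorem APHSWMEp_apply_add_two {N k : ℕ} (g h um α1 : ℝ) (i j : Fin (N + 2))
    (hj : (j : ℕ) = k + 2) :
    APHSWMEp N g h um α1 i j =
      (if (i : ℕ) = k + 1 then ((k : ℝ) + 2) / (2 * k + 3) * α1 else 0) +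
      (if (i : ℕ) = k + 2 then um else 0) +
      (if (i : ℕ) = k + 3 then ((k : ℝ) + 1) / (2 * k + 3) * α1 else 0) := by
  obtain ⟨i, hi⟩ := i
  obtain ⟨j, hj'⟩ := j
  obtain rfl : j = k + 2 := hj
  match i, hi with
  | 0, _ => simp [APHSWMEp]
  | 1, _ => rcases k with _ | k <;> simp [APHSWMEp]
  | i + 2, hi =>
    simp only [APHSWMEp, A2entry, Fin.mk.injEq, Nat.add_sub_cancel]
    rcases lt_trichotomy k (i + 1) with hk | rfl | hk
    · split_ifs <;> first | omega | simp_all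
    · simp
      exact .inl (by ring)
    · split_ifs <;> first | omega | simp_all

theorem add_mul_root_mem_spectrum_APHSWMEp {N : ℕ} (hN : 2 ≤ N) (g um : ℝ) {h α1 r : ℝ}
    (hh : h ≠ 0) (hα1 : α1 ≠ 0) (hr : (derivative (legendre (N + 1))).eval r = 0) :
    um + α1 * r ∈ spectrum ℝ (APHSWMEp N g h um α1) := by
  set q : ℕ → ℝ := fun n => (derivative (legendre n)).eval r with hq
  have hq0 : q 0 = 0 := by simp [hq, legendre_zero]
  have hq1 : q 1 = 1 := by simp [hq, derivative_legendre_one]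
  have hrec (n : ℕ) := eval_derivative_legendre_recurrence n r
  have hq2 : q 2 = 3 * r := by
    have := hrec 0
    simp only [zero_add] at this
    change (((0 : ℕ) : ℝ) + 1) * q 2 = (2 * ((0 : ℕ) : ℝ) + 3) * r * q 1 -
      (((0 : ℕ) : ℝ) + 2) * q 0 at this
    rw [hq0, hq1] at this
    simpa using this
  let w : ℕ → ℝ := fun i => Nat.casesOn i (-α1 / h) q
  have hw0 : w 0 = -α1 / h := rfl
  have hw1 : w 1 = 0 := hq0
  have hw2 : w 2 = 1 := hq1
  have hw3 : w 3 = 3 * r := hq2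
  have hws (i : ℕ) : w (i + 1) = q i := rfl
  refine Matrix.mem_spectrum_of_vecMul_eq_smul (v := fun i => w i) (fun hw => ?_) ?_
  · have := congrFun hw 0
    simp [hw0, hα1, hh] at this
  · ext j
    rw [Pi.smul_apply, smul_eq_mul, Matrix.vecMul, dotProduct]
    obtain hj | hj | ⟨k, hj⟩ : (j : ℕ) = 0 ∨ (j : ℕ) = 1 ∨ ∃ k, (j : ℕ) = k + 2 := by
      rcases hj : (j : ℕ) with _ | _ | k <;> simp
    · simp only [APHSWMEp_apply_zero g h um α1 _ j hj, mul_add, Finset.sum_add_distrib]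
      rw [Fin.sum_mul_ite_val_eq _ (by omega), Fin.sum_mul_ite_val_eq _ (by omega),
        Fin.sum_mul_ite_val_eq _ (by omega), hj, hw0, hw1, hw3]
      field_simp
      ring
    · simp only [APHSWMEp_apply_one g h um α1 _ j hj, mul_add, Finset.sum_add_distrib]
      rw [Fin.sum_mul_ite_val_eq _ (by omega), Fin.sum_mul_ite_val_eq _ (by omega),
        Fin.sum_mul_ite_val_eq _ (by omega), hj, hw0, hw1, hw2]
      field_simp
      ring
    · have hlast : k + 3 < N + 2 ∨ w (k + 3) = 0 := by
        by_cases hk : k + 3 < N + 2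
        · exact .inl hk
        · obtain rfl : N = k + 1 := by omega
          exact .inr hr
      simp only [APHSWMEp_apply_add_two g h um α1 _ j hj, mul_add, Finset.sum_add_distrib]
      rw [Fin.sum_mul_ite_val_eq _ (by omega), Fin.sum_mul_ite_val_eq _ (by omega),
        Fin.sum_mul_ite_val_eq _ hlast, hj, hws, hws, hws]
      have := hrec k
      change _ * q (k + 2) = _ * q (k + 1) - _ * q k at this
      have hk : (2 * (k : ℝ) + 3) ≠ 0 := by positivity
      field_simp
      linear_combination α1 * this

theorem add_mem_spectrum_APHSWMEp {N : ℕ} (hN : 2 ≤ N) (um : ℝ) {g h α1 s : ℝ}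
    (hh : h ≠ 0) (hs : s ^ 2 = g * h + α1 ^ 2) :
    um + s ∈ spectrum ℝ (APHSWMEp N g h um α1) := by
  obtain ⟨M, rfl⟩ := Nat.exists_eq_add_of_le' hN
  let v : Fin (M + 2 + 2) → ℝ := Fin.cons h (Fin.cons s (Fin.cons α1 0))
  refine Matrix.mem_spectrum_of_mulVec_eq_smul (v := v) (fun hv => ?_) ?_
  · exact hh (congrFun hv 0)
  · ext i
    rw [Pi.smul_apply, smul_eq_mul, Matrix.mulVec, dotProduct, Fin.sum_univ_succ,
      Fin.sum_univ_succ, Fin.sum_univ_succ, APHSWMEp_apply_zero _ _ _ _ _ _ rfl,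
      APHSWMEp_apply_one _ _ _ _ _ _ rfl, APHSWMEp_apply_add_two (k := 0) _ _ _ _ _ _ rfl]
    have hv0 : v 0 = h := rfl
    have hv1 : v (Fin.succ 0) = s := rfl
    have hv2 : v (Fin.succ (Fin.succ 0)) = α1 := rfl
    have hv3 (i : Fin (M + 1)) : v i.succ.succ.succ = 0 := rfl
    simp only [hv0, hv1, hv2, hv3, mul_zero, Finset.sum_const_zero]
    refine Fin.cases ?_ (fun i => Fin.cases ?_ (fun i => Fin.cases ?_ (fun i => ?_) i) i) i
    · rw [hv0]
      simp only [Fin.val_zero]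
      norm_num
      ring
    · rw [hv1]
      simp only [Fin.val_succ, Fin.val_zero]
      norm_num
      field_simp
      linear_combination -3 * hs
    · rw [hv2]
      simp only [Fin.val_succ, Fin.val_zero]
      norm_num
      ring
    · rw [hv3]
      rcases Fin.eq_zero_or_eq_succ i with rfl | ⟨i, rfl⟩
      · simp only [Fin.val_succ, Fin.val_zero]
        norm_num
        field_simp
        ring
      · simp

/-- The primitive PHSWME system matrix has `N+2` pairwise distinct real eigenvalues:
`u_m + α₁·r` for the `N` real roots `r` of `P'_{N+1}`, together with `u_m ± √(gh + α₁²)`;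
in particular it is real diagonalizable. -/
theorem stmt_11 (N : ℕ) (hN : 2 ≤ N) (g h um α1 : ℝ) (hg : 0 < g) (hh : 0 < h)
    (hα1 : α1 ≠ 0) :
    spectrum ℝ (APHSWMEp N g h um α1) =
        ((fun r => um + α1 * r) '' {r : ℝ | (derivative (legendre (N + 1))).eval r = 0}) ∪
          {um + Real.sqrt (g * h + α1 ^ 2), um - Real.sqrt (g * h + α1 ^ 2)} ∧
      (spectrum ℝ (APHSWMEp N g h um α1)).ncard = N + 2 ∧
      ∃ P D : Matrix (Fin (N + 2)) (Fin (N + 2)) ℝ,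
        IsUnit P ∧ D.IsDiag ∧ APHSWMEp N g h um α1 = P * D * P⁻¹ := by
  have hD : 0 < g * h + α1 ^ 2 := by positivity
  set s := Real.sqrt (g * h + α1 ^ 2)
  have hs : s ^ 2 = g * h + α1 ^ 2 := Real.sq_sqrt hD.le
  have hs0 : 0 < s := Real.sqrt_pos.2 hD
  set S : Set ℝ := ((fun r => um + α1 * r) ''
    {r : ℝ | (derivative (legendre (N + 1))).eval r = 0}) ∪ {um + s, um - s} with hS
  have hsub : S ⊆ spectrum ℝ (APHSWMEp N g h um α1) := by
    rintro x (⟨r, hr, rfl⟩ | rfl | rfl)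
    · exact add_mul_root_mem_spectrum_APHSWMEp hN g um hh.ne' hα1 hr
    · exact add_mem_spectrum_APHSWMEp hN um hh.ne' hs
    · rw [sub_eq_add_neg]
      exact add_mem_spectrum_APHSWMEp hN um hh.ne' (by rw [neg_sq, hs])
  obtain ⟨hfin, hle⟩ := (APHSWMEp N g h um α1).finite_spectrum_and_ncard_le
  rw [Fintype.card_fin] at hle
  have hlarge : N + 2 ≤ S.ncard := by
    have hinj : Function.Injective fun r : ℝ => um + α1 * r := fun a b hab =>
      mul_left_cancel₀ hα1 (add_left_cancel hab)
    have hdisj : Disjoint ((fun r => um + α1 * r) ''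
        {r : ℝ | (derivative (legendre (N + 1))).eval r = 0}) {um + s, um - s} := by
      rw [Set.disjoint_left]
      rintro _ ⟨r, hr, rfl⟩ hmem
      have hr1 := (sq_lt_one_iff_abs_lt_one r).2
        (abs_lt_one_of_eval_derivative_legendre_eq_zero hr)
      have hsq : (α1 * r) ^ 2 = s ^ 2 := by
        rcases hmem with hmem | hmem
        · rw [add_left_cancel hmem]
        · rw [sub_eq_add_neg] at hmem
          rw [add_left_cancel hmem, neg_sq]
      have : 0 < g * h := mul_pos hg hh
      have : 0 < α1 ^ 2 := by positivity
      nlinarith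
    rw [hS, Set.ncard_union_eq hdisj (hfin.subset (Set.subset_union_left.trans hsub))
        (Set.toFinite _), Set.ncard_image_of_injective _ hinj,
      setOf_eval_derivative_legendre_eq_zero, Set.ncard_coe_finset,
      Set.ncard_pair (by linarith)]
    exact Nat.add_le_add_right (le_card_roots_derivative_legendre N) 2
  have heq : S = spectrum ℝ (APHSWMEp N g h um α1) :=
    Set.eq_of_subset_of_ncard_le hsub (hle.trans hlarge) hfin
  have hcard : (spectrum ℝ (APHSWMEp N g h um α1)).ncard = N + 2 :=
    hle.antisymm (heq ▸ hlarge)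
  exact ⟨heq.symm, hcard, Matrix.exists_eq_mul_diagonal_mul_inv_of_ncard_spectrum _ (by simpa)⟩
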